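/- Fix ε = −1 (first type) or ε = +1 (second type) and suppose f ≡ k on J for a nonzero constant k, where J is an open interval containing more than one point (note the regularity conditions then force g'(u) ≠ 0 for all u ∈ J). Then the weighted mean curvature function H_φ is not constant on J. -/

import Mathlib

open Real Set

/-- Weighted mean curvature of the timelike general rotational surface `S_i`
(`ε = -1` for the first type, `ε = 1` for the second type) in `E₁⁴` with
density `e^{λ(x²+y²)+μ(z²−t²)}`. -/
noncomputable def Hphi (α β lam mu ε : ℝ) (f g : ℝ → ℝ) (u : ℝ) : ℝ :=
  |((α ^ 2 * f u * deriv g u + β ^ 2 * g u * deriv f u)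
      - 2 * ε * mu * (α ^ 2 * (f u) ^ 2 + ε * β ^ 2 * (g u) ^ 2) * deriv f u * g u)
     * ((deriv f u) ^ 2 - ε * (deriv g u) ^ 2)
   + (α ^ 2 * (f u) ^ 2 + ε * β ^ 2 * (g u) ^ 2)
     * (2 * ε * lam * ((deriv f u) ^ 2 - ε * (deriv g u) ^ 2) * f u * deriv g u
        - deriv g u * deriv (deriv f) u + deriv f u * deriv (deriv g) u)|
  / (2 * (ε * α ^ 2 * (f u) ^ 2 + β ^ 2 * (g u) ^ 2)
       * (-ε * (deriv f u) ^ 2 + (deriv g u) ^ 2) ^ ((3 : ℝ) / 2))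

/-- For constant `f` the weighted mean curvature is `|k| * |α² / (2 D) + λ|`, where
`D = ε α² k² + β² g²`. -/
lemma Hphi_of_const {α β lam mu ε k : ℝ} {f g : ℝ → ℝ} {u : ℝ} (hε : ε = -1 ∨ ε = 1)
    (hfk : ∀ u, f u = k) (hg : deriv g u ≠ 0)
    (hD : 0 < ε * α ^ 2 * k ^ 2 + β ^ 2 * g u ^ 2) :
    Hphi α β lam mu ε f g u
      = |k| * |α ^ 2 / (2 * (ε * α ^ 2 * k ^ 2 + β ^ 2 * g u ^ 2)) + lam| := by
  obtain rfl : f = fun _ => k := funext hfk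
  have hε2 : ε ^ 2 = 1 := by rcases hε with rfl | rfl <;> norm_num
  have hεabs : |ε| = 1 := by rcases hε with rfl | rfl <;> norm_num
  have hpow : (deriv g u ^ 2) ^ ((3 : ℝ) / 2) = |deriv g u| ^ 3 := by
    rw [← sq_abs, ← Real.rpow_natCast, ← Real.rpow_mul (abs_nonneg _), ← Real.rpow_natCast]
    norm_num
  have hg' : |deriv g u| ≠ 0 := abs_ne_zero.mpr hg
  simp only [Hphi, deriv_const', mul_zero, zero_mul, add_zero, sub_zero, zero_sub, ne_eq,
    OfNat.ofNat_ne_zero, not_false_eq_true, zero_pow, zero_add, hpow]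
  generalize hDdef : ε * α ^ 2 * k ^ 2 + β ^ 2 * g u ^ 2 = D at hD ⊢
  have hW : α ^ 2 * k ^ 2 + ε * β ^ 2 * g u ^ 2 = ε * D := by
    rw [← hDdef]; linear_combination (-α ^ 2 * k ^ 2) * hε2
  have hnum : α ^ 2 * k * deriv g u * -(ε * deriv g u ^ 2)
      + ε * D * (2 * ε * lam * -(ε * deriv g u ^ 2) * k * deriv g u)
      = -ε * k * deriv g u ^ 3 * (2 * D) * (α ^ 2 / (2 * D) + lam) := by
    field_simp
    linear_combination (-2 * k * ε * D * lam) * hε2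
  rw [hW, hnum]
  simp only [abs_mul, abs_neg, abs_pow, hεabs, abs_of_pos hD, abs_two]
  field_simp

/-- A function with nonzero derivative at a point of an open set does not have its square
confined to two values there. -/
lemma exists_sq_ne_of_deriv_ne_zero {g : ℝ → ℝ} {J : Set ℝ} (hJ : IsOpen J) {x : ℝ} (hx : x ∈ J)
    (hg : deriv g x ≠ 0) (a b : ℝ) : ∃ u ∈ J, g u ^ 2 ≠ a ∧ g u ^ 2 ≠ b := by
  have hd := (differentiableAt_of_deriv_ne_zero hg).hasDerivAt
  have hsq : ∀ {y c : ℝ}, y ≠ √c → y ≠ -√c → y ^ 2 ≠ c := by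
    rintro y c h₁ h₂ rfl
    rw [Real.sqrt_sq_eq_abs] at h₁ h₂
    rcases abs_choice y with h | h <;> rw [h] at h₁ h₂ <;> simp at h₁ h₂
  obtain ⟨u, ⟨⟨⟨h₁, h₂⟩, h₃⟩, h₄⟩, hu⟩ :=
    (((((hd.eventually_ne (c := √a) hg).and (hd.eventually_ne (c := -√a) hg)).and
      (hd.eventually_ne (c := √b) hg)).and (hd.eventually_ne (c := -√b) hg)).and
      (eventually_nhdsWithin_of_eventually_nhds (hJ.mem_nhds hx))).exists
  exact ⟨u, hu, hsq h₁ h₂, hsq h₃ h₄⟩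

theorem Hphi_of_const_f_not_constant
    (J : Set ℝ) (hJo : IsOpen J) (hJc : J.OrdConnected)
    (hJ2 : ∃ x ∈ J, ∃ y ∈ J, x ≠ y)
    (f g : ℝ → ℝ) (k : ℝ) (hk : k ≠ 0) (hfk : ∀ u, f u = k)
    (hg : ContDiffOn ℝ (⊤ : ℕ∞) g J)
    (α β lam mu ε : ℝ) (hα : 0 < α) (hβ : 0 < β) (hε : ε = -1 ∨ ε = 1)
    (hreg : ∀ u ∈ J, 0 < -ε * (deriv f u) ^ 2 + (deriv g u) ^ 2
        ∧ 0 < ε * α ^ 2 * (f u) ^ 2 + β ^ 2 * (g u) ^ 2) :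
    ¬ ∃ c : ℝ, ∀ u ∈ J, Hphi α β lam mu ε f g u = c := by
  rintro ⟨c, hc⟩
  obtain ⟨x, hx, -⟩ := hJ2
  have hder : ∀ u ∈ J, deriv g u ≠ 0 := by
    intro u hu h
    have := (hreg u hu).1
    rw [show f = fun _ => k from funext hfk, h] at this
    simp at this
  obtain ⟨u, hu, h₁, h₂⟩ := exists_sq_ne_of_deriv_ne_zero hJo hx (hder x hx)
    ((α ^ 2 / (2 * (c / |k| - lam)) - ε * α ^ 2 * k ^ 2) / β ^ 2)
    ((α ^ 2 / (2 * (-(c / |k|) - lam)) - ε * α ^ 2 * k ^ 2) / β ^ 2)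
  have hD := (hreg u hu).2
  rw [hfk] at hD
  have hH := hc u hu
  rw [Hphi_of_const hε hfk (hder u hu) hD] at hH
  have key : ∀ s : ℝ, α ^ 2 / (2 * (ε * α ^ 2 * k ^ 2 + β ^ 2 * g u ^ 2)) + lam = s →
      g u ^ 2 = (α ^ 2 / (2 * (s - lam)) - ε * α ^ 2 * k ^ 2) / β ^ 2 := by
    rintro s rfl
    have hDα : α ^ 2 / (2 * (α ^ 2 / (2 * (ε * α ^ 2 * k ^ 2 + β ^ 2 * g u ^ 2))))
        = ε * α ^ 2 * k ^ 2 + β ^ 2 * g u ^ 2 := by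
      generalize ε * α ^ 2 * k ^ 2 + β ^ 2 * g u ^ 2 = D at hD ⊢
      field_simp
    rw [add_sub_cancel_right, hDα]
    field_simp
    ring
  have habs : |α ^ 2 / (2 * (ε * α ^ 2 * k ^ 2 + β ^ 2 * g u ^ 2)) + lam| = c / |k| := by
    rw [eq_div_iff (abs_ne_zero.mpr hk), mul_comm, hH]
  rcases eq_or_eq_neg_of_abs_eq habs with h | h
  · exact h₁ (key _ h)
  · exact h₂ (key _ h)
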